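/- Let q = 2mn + 1 be a prime power with m, n > 2, and suppose the pair (m,n) is optimal, i.e., there exist two distinct odd primes dividing m and n respectively, and neither m_o·rad(m_o) divides n_o nor n_o·rad(n_o) divides m_o, where m_o, n_o are the odd parts of m, n. Then there exists a rank-one Heffter array H(m,n) over F_q whose group of multipliers has order exactly lcm(m_o, n_o) (i.e., an optimal rank-one H(m,n)). -/

import Mathlib

open scoped Classical Pointwise

/-- A half-set of the additive group of a finite field `F` of odd order `2ℓ+1`:
an `ℓ`-subset `L` with `L ∪ (-L) = F \ {0}`. -/
def IsHalfSet {F : Type*} [Field F] [Fintype F] (L : Finset F) : Prop :=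
  2 * L.card + 1 = Fintype.card F ∧
  L ∪ L.image (fun z => -z) = Finset.univ \ {0}

/-- A (tight) Heffter array `H(m,n)` over `F`: an `m × n` matrix with pairwise
distinct entries whose set of entries is a half-set of `(F,+)` and all of whose
row sums and column sums are zero. -/
def IsHeffter {F : Type*} [Field F] [Fintype F] {m n : ℕ}
    (A : Matrix (Fin m) (Fin n) F) : Prop :=
  Function.Injective (fun p : Fin m × Fin n => A p.1 p.2) ∧
  IsHalfSet (Finset.image (fun p : Fin m × Fin n => A p.1 p.2) Finset.univ) ∧
  (∀ i, ∑ j, A i j = 0) ∧ (∀ j, ∑ i, A i j = 0)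

/-- A multiplier of an `m × n` Heffter array `A` over `F`: a nonzero `u ∈ F` such
that either `u·a_{i,j} = a_{σ(i),τ(j)}` for permutations `σ`, `τ` of the rows and
columns, or (possible only when `m = n`) `u·a_{i,j} = a_{τ(j),σ(i)}`. -/
def IsMultiplier {F : Type*} [Field F] {m n : ℕ}
    (A : Matrix (Fin m) (Fin n) F) (u : F) : Prop :=
  u ≠ 0 ∧
  ((∃ (σ : Equiv.Perm (Fin m)) (τ : Equiv.Perm (Fin n)),
      ∀ i j, u * A i j = A (σ i) (τ j)) ∨
   (∃ (σ : Fin m ≃ Fin n) (τ : Fin n ≃ Fin m),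
      ∀ i j, u * A i j = A (τ j) (σ i)))

/-- The radical of a natural number: the product of its distinct prime divisors
(`rad 1 = 1`). -/
def rad (k : ℕ) : ℕ := ∏ p ∈ k.primeFactors, p

/-- If `M * rad M` does not divide `K`, some prime divisor of `M` has at least the same
multiplicity in `M` as in `K`. -/
lemma exists_prime_factorization_le {M K : ℕ} (hM : M ≠ 0) (hK : K ≠ 0)
    (h : ¬ M * rad M ∣ K) :
    ∃ p, p.Prime ∧ p ∣ M ∧ K.factorization p ≤ M.factorization p := by
  by_contra! hlt
  apply h
  have hprod : M * rad M = ∏ p ∈ M.primeFactors, p ^ (M.factorization p + 1) := by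
    simp only [pow_succ, Finset.prod_mul_distrib, rad]
    congr 1
    exact (Nat.prod_factorization_pow_eq_self hM).symm
  rw [hprod]
  refine Finset.prod_dvd_of_isRelPrime ?_ ?_
  · intro p hp r hr hpr
    rw [Function.onFun, ← Nat.coprime_iff_isRelPrime]
    exact Nat.Coprime.pow _ _ ((Nat.coprime_primes (Nat.prime_of_mem_primeFactors hp)
      (Nat.prime_of_mem_primeFactors hr)).2 hpr)
  · intro p hp
    have hpp := Nat.prime_of_mem_primeFactors hp
    exact (hpp.pow_dvd_iff_le_factorization hK).2
      (hlt p hpp (Nat.dvd_of_mem_primeFactors hp))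

lemma factorizationLCMLeft_ne_one {M K : ℕ} (hM : M ≠ 0) (hK : K ≠ 0)
    (h : ¬ M * rad M ∣ K) : Nat.factorizationLCMLeft M K ≠ 1 := by
  obtain ⟨p, hp, hpM, hle⟩ := exists_prime_factorization_le hM hK h
  intro hone
  have hl : Nat.lcm M K ≠ 0 := Nat.lcm_ne_zero hM hK
  have hpl : p ∣ Nat.lcm M K := hpM.trans (Nat.dvd_lcm_left M K)
  have hmem : p ∈ (Nat.lcm M K).factorization.support :=
    Nat.mem_primeFactors.2 ⟨hp, hpl, hl⟩
  have hdvd := Finset.dvd_prod_of_mem (fun r => if K.factorization r ≤ M.factorization r then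
    r ^ (Nat.lcm M K).factorization r else 1) hmem
  simp only [hle, if_true] at hdvd
  have : p ∣ Nat.factorizationLCMLeft M K :=
    (dvd_pow_self p (hp.factorization_pos_of_dvd hl hpl).ne').trans hdvd
  rw [hone] at this
  exact hp.one_lt.ne' (Nat.dvd_one.1 this)

/-- The least common multiple of `M` and `K` splits into nontrivial coprime divisors
of `M` and `K`. -/
lemma exists_coprime_mul_eq_lcm {M K p p' : ℕ} (hM : M ≠ 0) (hK : K ≠ 0)
    (h1 : ¬ M * rad M ∣ K) (h2 : ¬ K * rad K ∣ M) (hp : p.Prime) (hp' : p'.Prime)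
    (hne : p ≠ p') (hpM : p ∣ M) (hpK : p' ∣ K) :
    ∃ a b, a ∣ M ∧ b ∣ K ∧ a.Coprime b ∧ a * b = Nat.lcm M K ∧ a ≠ 1 ∧ b ≠ 1 := by
  by_cases hR : Nat.factorizationLCMRight M K = 1
  · by_cases hR' : Nat.factorizationLCMRight K M = 1
    · have e1 := Nat.factorizationLCMLeft_mul_factorizationLCMRight hM hK
      have e2 := Nat.factorizationLCMLeft_mul_factorizationLCMRight hK hM
      rw [hR, mul_one] at e1
      rw [hR', mul_one] at e2
      have hKM : K ∣ M := ((Nat.dvd_lcm_right M K).trans e1.symm.dvd).trans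
        (Nat.factorizationLCMLeft_dvd_left M K)
      have hMK : M ∣ K := ((Nat.dvd_lcm_right K M).trans e2.symm.dvd).trans
        (Nat.factorizationLCMLeft_dvd_left K M)
      obtain rfl := Nat.dvd_antisymm hMK hKM
      refine ⟨ordProj[p] M, ordCompl[p] M, Nat.ordProj_dvd M p, Nat.ordCompl_dvd M p,
        (Nat.coprime_ordCompl hp hM).pow_left _, ?_, ?_, ?_⟩
      · rw [Nat.lcm_self, Nat.ordProj_mul_ordCompl_eq_self]
      · exact (Nat.one_lt_pow (hp.factorization_pos_of_dvd hM hpM).ne' hp.one_lt).ne'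
      · intro h
        have := Nat.dvd_ordCompl_of_dvd_not_dvd hpK
          (fun h => hne ((Nat.prime_dvd_prime_iff_eq hp hp').1 h))
        rw [h] at this
        exact hp'.one_lt.ne' (Nat.dvd_one.1 this)
    · exact ⟨_, _, Nat.factorizationLCMRight_dvd_right K M,
        Nat.factorizationLCMLeft_dvd_left K M,
        (Nat.coprime_factorizationLCMLeft_factorizationLCMRight K M).symm,
        by rw [mul_comm, Nat.factorizationLCMLeft_mul_factorizationLCMRight hK hM, Nat.lcm_comm],
        hR', factorizationLCMLeft_ne_one hK hM h2⟩
  · exact ⟨_, _, Nat.factorizationLCMLeft_dvd_left M K,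
      Nat.factorizationLCMRight_dvd_right M K,
      Nat.coprime_factorizationLCMLeft_factorizationLCMRight M K,
      Nat.factorizationLCMLeft_mul_factorizationLCMRight hM hK,
      factorizationLCMLeft_ne_one hM hK h1, hR⟩

/-- A multiplicative permutation of a family of nonzero elements, no two of which are
opposite, is given by an element whose order divides the odd part of the family's size. -/
lemma pow_ordCompl_two_eq_one {F : Type*} [Field F] {m : ℕ} (hm : 0 < m)
    {x : Fin m → F} (hx0 : ∀ i, x i ≠ 0) (hneg : ∀ i j, x i ≠ -x j)
    {c : F} {σ : Equiv.Perm (Fin m)} (hσ : ∀ i, c * x i = x (σ i)) :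
    c ^ (ordCompl[2] m) = 1 := by
  have hcm : c ^ m = 1 := by
    have h : ∏ i, (c * x i) = ∏ i, x i := by
      simp only [hσ]
      exact Equiv.prod_comp σ x
    rw [Finset.prod_mul_distrib, Finset.prod_const, Finset.card_univ, Fintype.card_fin] at h
    exact mul_right_cancel₀ (Finset.prod_ne_zero_iff.2 fun i _ => hx0 i) (h.trans (one_mul _).symm)
  have hiter : ∀ k i, ∃ j, c ^ k * x i = x j := by
    intro k
    induction k with
    | zero => exact fun i => ⟨i, by simp⟩
    | succ k ih =>
      intro i
      obtain ⟨j, hj⟩ := ih (σ i)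
      exact ⟨j, by rw [← hj, ← hσ, pow_succ, mul_assoc]⟩
  apply orderOf_dvd_iff_pow_eq_one.1
  refine Nat.dvd_ordCompl_of_dvd_not_dvd (orderOf_dvd_iff_pow_eq_one.2 hcm) ?_
  rintro ⟨d, hd⟩
  have hpos : 0 < orderOf c := orderOf_pos_iff.2 (isOfFinOrder_iff_pow_eq_one.2 ⟨m, hm, hcm⟩)
  have hsq : (c ^ d) ^ 2 = 1 := by rw [← pow_mul, mul_comm, ← hd, pow_orderOf_eq_one]
  rcases eq_or_eq_neg_of_sq_eq_sq _ _ (hsq.trans (one_pow 2).symm) with h | h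
  · have := Nat.le_of_dvd (by omega) (orderOf_dvd_iff_pow_eq_one.2 h)
    omega
  · obtain ⟨j, hj⟩ := hiter d ⟨0, hm⟩
    rw [h] at hj
    exact hneg j ⟨0, hm⟩ (by rw [← hj, neg_one_mul])

/-- A nonzero scalar mapping an injective finite family into itself permutes it. -/
lemma exists_perm_of_mul_mem_range {F ι : Type*} [Field F] [Finite ι] {x : ι → F}
    (hx : Function.Injective x) {c : F} (hc : c ≠ 0) (h : ∀ i, ∃ j, c * x i = x j) :
    ∃ σ : Equiv.Perm ι, ∀ i, c * x i = x (σ i) := by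
  choose f hf using h
  have hinj : Function.Injective f := fun i j hij =>
    hx (mul_left_cancel₀ hc (by rw [hf, hf, hij]))
  exact ⟨Equiv.ofBijective f (Finite.injective_iff_bijective.1 hinj), hf⟩

/-- If the squares of the products `x i * y j` are nonzero and distinct, the products form a
half-set, and zero sums of `x` and `y` make the outer product a Heffter array. -/
lemma isHeffter_vecMulVec {F : Type*} [Field F] [Fintype F] {m n : ℕ}
    (hq : Fintype.card F = 2 * m * n + 1) {x : Fin m → F} {y : Fin n → F}
    (hx0 : ∀ i, x i ≠ 0) (hy0 : ∀ j, y j ≠ 0)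
    (hinj : Function.Injective fun p : Fin m × Fin n => (x p.1 * y p.2) ^ 2)
    (hneg : ∀ i i' j j', x i * y j ≠ -(x i' * y j'))
    (hx : ∑ i, x i = 0) (hy : ∑ j, y j = 0) :
    IsHeffter (Matrix.vecMulVec x y) := by
  have hinj' : Function.Injective fun p : Fin m × Fin n => x p.1 * y p.2 :=
    Function.Injective.of_comp (f := fun z : F => z ^ 2) hinj
  have hcard : (Finset.image (fun p : Fin m × Fin n => x p.1 * y p.2) Finset.univ).card
      = m * n := by
    rw [Finset.card_image_of_injective _ hinj']
    simp
  simp only [IsHeffter, IsHalfSet, Matrix.vecMulVec_apply]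
  refine ⟨hinj', ⟨by rw [hcard, hq, mul_assoc], ?_⟩, ?_, ?_⟩
  · apply Finset.eq_of_subset_of_card_le
    · intro z
      simp only [Finset.mem_union, Finset.mem_image, Finset.mem_univ, true_and, Finset.mem_sdiff,
        Finset.mem_singleton]
      rintro (⟨p, rfl⟩ | ⟨_, ⟨p, rfl⟩, rfl⟩)
      · exact mul_ne_zero (hx0 _) (hy0 _)
      · exact neg_ne_zero.2 (mul_ne_zero (hx0 _) (hy0 _))
    · rw [Finset.card_union_of_disjoint, Finset.card_image_of_injective _ neg_injective, hcard,
        Finset.card_sdiff_of_subset (Finset.subset_univ _), Finset.card_univ, hq,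
        Finset.card_singleton]
      · lia
      · rw [Finset.disjoint_left]
        simp only [Finset.mem_image, Finset.mem_univ, true_and]
        rintro _ ⟨p, rfl⟩ ⟨_, ⟨p', rfl⟩, h⟩
        exact hneg _ _ _ _ h.symm
  · intro i
    rw [← Finset.mul_sum, hy, mul_zero]
  · intro j
    rw [← Finset.sum_mul, hx, zero_mul]

lemma rank_vecMulVec_eq_one {F : Type*} [Field F] {m n : ℕ} {x : Fin m → F} {y : Fin n → F}
    {i : Fin m} {j : Fin n} (hx : x i ≠ 0) (hy : y j ≠ 0) :
    (Matrix.vecMulVec x y).rank = 1 := by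
  apply le_antisymm (Matrix.rank_vecMulVec_le x y)
  rw [Nat.one_le_iff_ne_zero]
  intro h
  rw [Matrix.rank, Submodule.finrank_eq_zero, LinearMap.range_eq_bot] at h
  have h' := congrFun (LinearMap.congr_fun h (Pi.single j 1)) i
  simp only [Matrix.mulVecLin_apply, Matrix.mulVec_single_one, Matrix.col_apply,
    Matrix.vecMulVec_apply, LinearMap.zero_apply, Pi.zero_apply] at h'
  exact mul_ne_zero hx hy h'

/-- Every multiplier of an outer product is a product of scalars permuting the two factors, or
(in the transposed case) a scalar permuting the first factor. -/
lemma exists_of_isMultiplier_vecMulVec {F : Type*} [Field F] {m n : ℕ}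
    (hm : 0 < m) (hn : 0 < n) {x : Fin m → F} {y : Fin n → F}
    (hx0 : ∀ i, x i ≠ 0) (hy0 : ∀ j, y j ≠ 0) {u : F}
    (hu : IsMultiplier (Matrix.vecMulVec x y) u) :
    ∃ c d : F, u = c * d ∧ (∃ σ : Equiv.Perm (Fin m), ∀ i, c * x i = x (σ i)) ∧
      ∃ τ : Equiv.Perm (Fin n), ∀ j, d * y j = y (τ j) := by
  let i₀ : Fin m := ⟨0, hm⟩
  let j₀ : Fin n := ⟨0, hn⟩
  simp only [IsMultiplier, Matrix.vecMulVec_apply] at hu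
  obtain ⟨hu0, ⟨σ, τ, h⟩ | ⟨σ, τ, h⟩⟩ := hu
  · refine ⟨u * y j₀ / y (τ j₀), y (τ j₀) / y j₀, ?_, ⟨σ, fun i => ?_⟩, τ, fun j => ?_⟩
    · have := hy0 j₀
      have := hy0 (τ j₀)
      field_simp
    · have h1 := h i j₀
      have := hy0 (τ j₀)
      field_simp
      linear_combination h1
    · have h1 := h i₀ j
      have h2 := h i₀ j₀
      have := hy0 j₀
      field_simp
      apply mul_left_cancel₀ (mul_ne_zero hu0 (mul_ne_zero (hx0 i₀) (hx0 (σ i₀))))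
      linear_combination (x (σ i₀) * y (τ j₀)) * h1 - x (σ i₀) * y (τ j) * h2
  · refine ⟨u, 1, by simp, ⟨σ.trans τ, fun i => ?_⟩, Equiv.refl _, by simp⟩
    have h1 := h i (σ i)
    apply mul_right_cancel₀ (hy0 (σ i))
    simpa [mul_assoc] using h1

/-- The outer product built from a generator `g` of the multiplicative group and its
powers of orders `a` and `b`. -/
lemma exists_heffter_of_coprime {F : Type*} [Field F] [Fintype F] {a b k l : ℕ}
    (ha : 1 < a) (hb : 1 < b) (hk : 0 < k) (hl : 0 < l) (ha2 : Nat.Coprime 2 a)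
    (hb2 : Nat.Coprime 2 b) (hab : a.Coprime b)
    (hq : Fintype.card F = 2 * (a * k) * (b * l) + 1)
    (hlcm : a * b = Nat.lcm (ordCompl[2] (a * k)) (ordCompl[2] (b * l))) :
    ∃ A : Matrix (Fin (a * k)) (Fin (b * l)) F, IsHeffter A ∧ A.rank = 1 ∧
      {u : F | IsMultiplier A u}.ncard = a * b := by
  have ha0 : 0 < a := by omega
  have hb0 : 0 < b := by omega
  have : NeZero a := ⟨ha0.ne'⟩
  have : NeZero b := ⟨hb0.ne'⟩
  have hm : 0 < a * k := by positivity
  have hn : 0 < b * l := by positivity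
  obtain ⟨g, hg⟩ : ∃ g : F, IsPrimitiveRoot g (2 * (a * k) * (b * l)) := by
    obtain ⟨g, hg⟩ := IsCyclic.exists_generator (α := Fˣ)
    refine ⟨g, IsPrimitiveRoot.coe_units_iff.2 ?_⟩
    have := orderOf_eq_card_of_forall_mem_zpowers hg
    rw [Nat.card_eq_fintype_card, Fintype.card_units, hq, Nat.add_sub_cancel] at this
    exact this ▸ IsPrimitiveRoot.orderOf g
  have hpos : 0 < 2 * (a * k) * (b * l) := by positivity
  have hg0 : g ≠ 0 := hg.ne_zero hpos.ne'
  obtain ⟨α, hα⟩ : ∃ α : F, IsPrimitiveRoot α a := ⟨_, hg.pow hpos (b := a)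
    (a := 2 * k * (b * l)) (by ring)⟩
  obtain ⟨β, hβ⟩ : ∃ β : F, IsPrimitiveRoot β b := ⟨_, hg.pow hpos (b := b)
    (a := 2 * (a * k) * l) (by ring)⟩
  obtain ⟨γ, hγ⟩ : ∃ γ : F, IsPrimitiveRoot γ (a * b) := ⟨_, hg.pow hpos (b := a * b)
    (a := 2 * k * l) (by ring)⟩
  have hα0 : α ≠ 0 := hα.ne_zero ha0.ne'
  have hβ0 : β ≠ 0 := hβ.ne_zero hb0.ne'
  let e : Fin (a * k) ≃ Fin a × Fin k := finProdFinEquiv.symm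
  let f : Fin (b * l) ≃ Fin b × Fin l := finProdFinEquiv.symm
  let x : Fin (a * k) → F := fun i => α ^ ((e i).1 : ℕ) * g ^ ((e i).2 : ℕ)
  let y : Fin (b * l) → F := fun j => β ^ ((f j).1 : ℕ) * g ^ (k * ((f j).2 : ℕ))
  have hx0 : ∀ i, x i ≠ 0 := fun i => mul_ne_zero (pow_ne_zero _ hα0) (pow_ne_zero _ hg0)
  have hy0 : ∀ j, y j ≠ 0 := fun j => mul_ne_zero (pow_ne_zero _ hβ0) (pow_ne_zero _ hg0)
  have hαpow : ∀ r s : ℕ, (α ^ r) ^ (a * s) = 1 := fun r s => by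
    rw [← pow_mul, mul_left_comm, pow_mul, hα.pow_eq_one, one_pow]
  have hβpow : ∀ r s : ℕ, (β ^ r) ^ (b * s) = 1 := fun r s => by
    rw [← pow_mul, mul_left_comm, pow_mul, hβ.pow_eq_one, one_pow]
  have hinj : Function.Injective fun p : Fin (a * k) × Fin (b * l) => (x p.1 * y p.2) ^ 2 := by
    rintro ⟨i, j⟩ ⟨i', j'⟩ h
    have hpow : ∀ i j, ((x i * y j) ^ 2) ^ (a * b)
        = g ^ (2 * a * b * ((e i).2 + k * (f j).2)) := by
      intro i j
      calc ((x i * y j) ^ 2) ^ (a * b)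
          = (α ^ ((e i).1 : ℕ)) ^ (a * (2 * b)) * (β ^ ((f j).1 : ℕ)) ^ (b * (2 * a))
            * g ^ (2 * a * b * ((e i).2 + k * (f j).2)) := by simp only [x, y]; ring
        _ = _ := by rw [hαpow, hβpow, one_mul, one_mul]
    have hlt : ∀ i j, 2 * a * b * (((e i).2 : ℕ) + k * (f j).2) < 2 * (a * k) * (b * l) := by
      intro i j
      have h1 := (e i).2.isLt
      have h2 := (f j).2.isLt
      have h3 : ((e i).2 : ℕ) + k * (f j).2 < k * l := by nlinarith
      calc _ < 2 * a * b * (k * l) := Nat.mul_lt_mul_of_pos_left h3 (by positivity)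
        _ = _ := by ring
    have hexp := congrArg (· ^ (a * b)) h
    simp only [hpow] at hexp
    have hexp' := Nat.eq_of_mul_eq_mul_left (by positivity)
      (hg.pow_inj (hlt i j) (hlt i' j') hexp)
    have ht : ((e i).2 : ℕ) = (e i').2 := by
      have := congrArg (· % k) hexp'
      simpa [Nat.add_mul_mod_self_left, Nat.mod_eq_of_lt] using this
    have ht' : ((f j).2 : ℕ) = (f j').2 := by
      rw [ht] at hexp'
      exact Nat.eq_of_mul_eq_mul_left hk (Nat.add_left_cancel hexp')
    have hroot : (α ^ ((e i).1 : ℕ) * β ^ ((f j).1 : ℕ)) ^ 2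
        = (α ^ ((e i').1 : ℕ) * β ^ ((f j').1 : ℕ)) ^ 2 := by
      have hG : (g ^ ((e i').2 : ℕ) * g ^ (k * ((f j').2 : ℕ))) ^ 2 ≠ 0 :=
        pow_ne_zero _ (mul_ne_zero (pow_ne_zero _ hg0) (pow_ne_zero _ hg0))
      apply mul_right_cancel₀ hG
      simp only [x, y, ht, ht'] at h
      linear_combination h
    have hs : ((e i).1 : ℕ) = (e i').1 := by
      have hprim := hα.pow_of_coprime (2 * b) (Nat.Coprime.mul_left ha2 hab.symm)
      apply hprim.pow_inj (e i).1.isLt (e i').1.isLt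
      have := congrArg (· ^ b) hroot
      calc (α ^ (2 * b)) ^ ((e i).1 : ℕ)
          = ((α ^ ((e i).1 : ℕ) * β ^ ((f j).1 : ℕ)) ^ 2) ^ b := by
            rw [← mul_one ((α ^ (2 * b)) ^ _), ← hβpow (f j).1 2]; ring
        _ = ((α ^ ((e i').1 : ℕ) * β ^ ((f j').1 : ℕ)) ^ 2) ^ b := this
        _ = (α ^ (2 * b)) ^ ((e i').1 : ℕ) := by
            rw [← mul_one ((α ^ (2 * b)) ^ _), ← hβpow (f j').1 2]; ring
    have hs' : ((f j).1 : ℕ) = (f j').1 := by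
      have hprim := hβ.pow_of_coprime 2 hb2
      apply hprim.pow_inj (f j).1.isLt (f j').1.isLt
      apply mul_left_cancel₀ (pow_ne_zero 2 (pow_ne_zero ((e i').1 : ℕ) hα0))
      rw [hs] at hroot
      linear_combination hroot
    exact Prod.ext (e.injective (Prod.ext (Fin.ext hs) (Fin.ext ht)))
      (f.injective (Prod.ext (Fin.ext hs') (Fin.ext ht')))
  have hchar : (2 : F) ≠ 0 := by
    intro h
    have h0 : ((Fintype.card F : ℕ) : F) = 0 := Nat.cast_card_eq_zero F
    rw [hq] at h0
    push_cast at h0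
    rw [h] at h0
    simp at h0
  have hneg : ∀ i i' j j', x i * y j ≠ -(x i' * y j') := by
    intro i i' j j' h
    have hsq : (x i * y j) ^ 2 = (x i' * y j') ^ 2 := by rw [h, neg_sq]
    obtain ⟨rfl, rfl⟩ := Prod.ext_iff.1 (@hinj (i, j) (i', j') hsq)
    have h2 : 2 * (x i * y j) = 0 := by linear_combination h
    exact mul_ne_zero hchar (mul_ne_zero (hx0 i) (hy0 j)) h2
  have hsum : ∀ {c r : ℕ} {ζ : F} (_ : IsPrimitiveRoot ζ c) (_ : 1 < c) (w : ℕ → F),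
      ∑ i : Fin (c * r), ζ ^ ((finProdFinEquiv.symm i).1 : ℕ) * w (finProdFinEquiv.symm i).2
        = 0 := by
    intro c r ζ hζ hc w
    rw [Equiv.sum_comp finProdFinEquiv.symm
      (fun z : Fin c × Fin r => ζ ^ (z.1 : ℕ) * w z.2), Fintype.sum_prod_type]
    dsimp only
    rw [← Finset.sum_mul_sum, Fin.sum_univ_eq_sum_range (fun s => ζ ^ s), hζ.geom_sum_eq_zero hc,
      zero_mul]
  have hxinj : Function.Injective x := by
    intro i i' h
    have := @hinj (i, ⟨0, hn⟩) (i', ⟨0, hn⟩) (by simp only [h])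
    exact (Prod.ext_iff.1 this).1
  have hyinj : Function.Injective y := by
    intro j j' h
    have := @hinj (⟨0, hm⟩, j) (⟨0, hm⟩, j') (by simp only [h])
    exact (Prod.ext_iff.1 this).2
  refine ⟨Matrix.vecMulVec x y, isHeffter_vecMulVec hq hx0 hy0 hinj hneg
    (hsum hα ha fun t => g ^ t) (hsum hβ hb fun t => g ^ (k * t)),
    rank_vecMulVec_eq_one (hx0 ⟨0, hm⟩) (hy0 ⟨0, hn⟩), ?_⟩
  have hset : {u : F | IsMultiplier (Matrix.vecMulVec x y) u}
      = Polynomial.nthRootsFinset (a * b) (1 : F) := by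
    ext u
    rw [Finset.mem_coe, Polynomial.mem_nthRootsFinset (by positivity), Set.mem_ofPred_eq]
    constructor
    · intro hu
      obtain ⟨c, d, rfl, ⟨σ, hσ⟩, τ, hτ⟩ :=
        exists_of_isMultiplier_vecMulVec hm hn hx0 hy0 hu
      have hc := pow_ordCompl_two_eq_one hm hx0
        (fun i i' h => hneg i i' ⟨0, hn⟩ ⟨0, hn⟩ (by rw [h, neg_mul])) hσ
      have hd := pow_ordCompl_two_eq_one hn hy0
        (fun j j' h => hneg ⟨0, hm⟩ ⟨0, hm⟩ j j' (by rw [h, mul_neg])) hτ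
      rw [mul_pow, hlcm, orderOf_dvd_iff_pow_eq_one.1
        ((orderOf_dvd_iff_pow_eq_one.2 hc).trans (Nat.dvd_lcm_left _ _)),
        orderOf_dvd_iff_pow_eq_one.1
        ((orderOf_dvd_iff_pow_eq_one.2 hd).trans (Nat.dvd_lcm_right _ _)), one_mul]
    · intro hu
      have hu0 : u ≠ 0 := by
        rintro rfl
        rw [zero_pow (by positivity)] at hu
        exact zero_ne_one hu
      obtain ⟨c, d, hcd, hc, hd⟩ : ∃ c d : F, u = c * d ∧ c ^ a = 1 ∧ d ^ b = 1 := by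
        refine ⟨u ^ ((b : ℤ) * Nat.gcdB a b), u ^ ((a : ℤ) * Nat.gcdA a b), ?_, ?_, ?_⟩
        · rw [← zpow_add₀ hu0, add_comm, ← Nat.gcd_eq_gcd_ab, hab.gcd_eq_one, Nat.cast_one,
            zpow_one]
        · rw [← zpow_natCast, ← zpow_mul, show (b : ℤ) * Nat.gcdB a b * (a : ℕ)
            = ((a * b : ℕ) : ℤ) * Nat.gcdB a b by push_cast; ring, zpow_mul, zpow_natCast, hu,
            one_zpow]
        · rw [← zpow_natCast, ← zpow_mul, show (a : ℤ) * Nat.gcdA a b * (b : ℕ)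
            = ((a * b : ℕ) : ℤ) * Nat.gcdA a b by push_cast; ring, zpow_mul, zpow_natCast, hu,
            one_zpow]
      have hc0 : c ≠ 0 := fun h => hu0 (by rw [hcd, h, zero_mul])
      have hd0 : d ≠ 0 := fun h => hu0 (by rw [hcd, h, mul_zero])
      obtain ⟨σ, hσ⟩ := exists_perm_of_mul_mem_range hxinj hc0 fun i => by
        obtain ⟨s, hs, h⟩ := hα.eq_pow_of_pow_eq_one (ξ := c * α ^ ((e i).1 : ℕ))
          (by simpa [mul_pow, hc] using hαpow (e i).1 1)
        refine ⟨e.symm (⟨s, hs⟩, (e i).2), ?_⟩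
        simp only [x, Equiv.apply_symm_apply, h, mul_assoc]
      obtain ⟨τ, hτ⟩ := exists_perm_of_mul_mem_range hyinj hd0 fun j => by
        obtain ⟨s, hs, h⟩ := hβ.eq_pow_of_pow_eq_one (ξ := d * β ^ ((f j).1 : ℕ))
          (by simpa [mul_pow, hd] using hβpow (f j).1 1)
        refine ⟨f.symm (⟨s, hs⟩, (f j).2), ?_⟩
        simp only [y, Equiv.apply_symm_apply, h, mul_assoc]
      refine ⟨hu0, Or.inl ⟨σ, τ, fun i j => ?_⟩⟩
      rw [Matrix.vecMulVec_apply, Matrix.vecMulVec_apply, ← hσ, ← hτ, hcd]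
      ring
  rw [hset, Set.ncard_coe_finset, hγ.card_nthRootsFinset]

/-- If `q = 2mn + 1` is a prime power with `m, n > 2` and the pair
`(m,n)` is optimal (there are distinct odd primes dividing `m` and `n`, and neither
`m_o·rad(m_o) ∣ n_o` nor `n_o·rad(n_o) ∣ m_o`, where `m_o`, `n_o` are the odd
parts), then there exists an optimal rank-one Heffter array `H(m,n)` over `F_q`,
i.e. one whose group of multipliers has order exactly `lcm(m_o, n_o)`. -/
theorem heffter_stmt_17 {F : Type*} [Field F] [Fintype F] (m n : ℕ)
    (hm : 2 < m) (hn : 2 < n) (hq : Fintype.card F = 2 * m * n + 1)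
    (hagree : ∃ p p' : ℕ, p.Prime ∧ p'.Prime ∧ Odd p ∧ Odd p' ∧ p ≠ p' ∧ p ∣ m ∧ p' ∣ n)
    (h1 : ¬ (ordCompl[2] m * rad (ordCompl[2] m) ∣ ordCompl[2] n))
    (h2 : ¬ (ordCompl[2] n * rad (ordCompl[2] n) ∣ ordCompl[2] m)) :
    ∃ A : Matrix (Fin m) (Fin n) F, IsHeffter A ∧ A.rank = 1 ∧
      {u : F | IsMultiplier A u}.ncard = Nat.lcm (ordCompl[2] m) (ordCompl[2] n) := by
  obtain ⟨p, p', hp, hp', hpo, hpo', hne, hpm, hpn⟩ := hagree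
  have hM := (Nat.ordCompl_pos 2 (by omega : m ≠ 0)).ne'
  have hN := (Nat.ordCompl_pos 2 (by omega : n ≠ 0)).ne'
  have hodd : ∀ {r t : ℕ}, r.Prime → Odd r → r ∣ t → r ∣ ordCompl[2] t := fun hr ho ht =>
    Nat.dvd_ordCompl_of_dvd_not_dvd ht (fun h => (Nat.not_even_iff_odd.2 ho)
      (even_iff_two_dvd.2 h))
  obtain ⟨a, b, ham, hbn, hab, hlcm, ha1, hb1⟩ := exists_coprime_mul_eq_lcm hM hN h1 h2 hp hp'
    hne (hodd hp hpo hpm) (hodd hp' hpo' hpn)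
  have ha2 : Nat.Coprime 2 a :=
    (Nat.coprime_ordCompl Nat.prime_two (by omega)).coprime_dvd_right ham
  have hb2 : Nat.Coprime 2 b :=
    (Nat.coprime_ordCompl Nat.prime_two (by omega)).coprime_dvd_right hbn
  obtain ⟨k, rfl⟩ := ham.trans (Nat.ordCompl_dvd m 2)
  obtain ⟨l, rfl⟩ := hbn.trans (Nat.ordCompl_dvd n 2)
  rw [← hlcm]
  have ha0 : a ≠ 0 := by rintro rfl; simp at hm
  have hb0 : b ≠ 0 := by rintro rfl; simp at hn
  have hk0 : k ≠ 0 := by rintro rfl; simp at hm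
  have hl0 : l ≠ 0 := by rintro rfl; simp at hn
  exact exists_heffter_of_coprime (by omega) (by omega) (by omega) (by omega) ha2 hb2 hab hq hlcm
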